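/- Let x be a centered σ_x²-subgaussian random variable and y an independent centered σ_y²-subgaussian random variable, i.e. E[exp(tx)] ≤ exp(σ_x² t²/2) and E[exp(ty)] ≤ exp(σ_y² t²/2) for all t. Then there is a universal constant b such that E[exp(t·x·y)] ≤ exp(b² σ_x² σ_y² t²) for all |t| ≤ (b σ_x σ_y)^{-1}. -/

import Mathlib

open MeasureTheory ProbabilityTheory

theorem nullMeasurableSet_of_measure_add_measure_compl_le {Ω : Type*} [MeasurableSpace Ω]
    {μ : Measure Ω} [IsProbabilityMeasure μ] {s : Set Ω} (h : μ s + μ sᶜ ≤ 1) :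
    NullMeasurableSet s μ := by
  have hdiff : μ (toMeasurable μ s \ (toMeasurable μ sᶜ)ᶜ) = 0 := by
    have hcover : toMeasurable μ s ∪ toMeasurable μ sᶜ = Set.univ := by
      refine Set.eq_univ_of_univ_subset ?_
      rw [← Set.union_compl_self s]
      exact Set.union_subset_union (subset_toMeasurable _ _) (subset_toMeasurable _ _)
    have h1 := measure_union_add_inter (μ := μ) (toMeasurable μ s)
      (measurableSet_toMeasurable μ sᶜ)
    rw [hcover, measure_univ, measure_toMeasurable, measure_toMeasurable] at h1
    rw [Set.sdiff_compl]
    have h2 : 1 + μ (toMeasurable μ s ∩ toMeasurable μ sᶜ) ≤ 1 + 0 := by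
      rw [h1, add_zero]; exact h
    exact le_antisymm ((ENNReal.add_le_add_iff_left ENNReal.one_ne_top).1 h2) zero_le
  refine (measurableSet_toMeasurable μ s).nullMeasurableSet.congr ?_
  refine (ae_le_set.2 ?_).antisymm (ae_le_set.2 ?_)
  · refine measure_mono_null (Set.sdiff_subset_sdiff_right ?_) hdiff
    exact Set.compl_subset_comm.1 (subset_toMeasurable μ sᶜ)
  · rw [Set.sdiff_eq_empty.2 (subset_toMeasurable μ s), measure_empty]

theorem exists_Ico_measure_preimage_ne_zero {Ω : Type*} [MeasurableSpace Ω] {μ : Measure Ω}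
    {y : Ω → ℝ} (hy : μ {ω | 0 < y ω} ≠ 0) {r : ℝ} (hr : 1 < r) :
    ∃ c : ℝ, 0 < c ∧ μ (y ⁻¹' Set.Ico c (c * r)) ≠ 0 := by
  by_contra! hcon
  refine hy (measure_mono_null (t := ⋃ n : ℤ, y ⁻¹' Set.Ico (r ^ n) (r ^ n * r)) ?_ ?_)
  · intro ω hω
    obtain ⟨n, hn⟩ := exists_mem_Ico_zpow (show 0 < y ω from hω) hr
    rw [zpow_add_one₀ (by positivity)] at hn
    exact Set.mem_iUnion.2 ⟨n, hn⟩
  · exact measure_iUnion_null fun n => hcon _ (by positivity)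

theorem ProbabilityTheory.IndepFun.measure_le_add_measure_ge_le_one {Ω : Type*}
    [MeasurableSpace Ω] {μ : Measure Ω} [IsProbabilityMeasure μ] {x y : Ω → ℝ}
    (h : IndepFun x y μ) (hxy : AEMeasurable (fun ω => x ω * y ω) μ)
    (hy : μ {ω | 0 < y ω} ≠ 0) {a a' : ℝ} (ha : a < a') :
    μ (x ⁻¹' Set.Iic a) + μ (x ⁻¹' Set.Ici a') ≤ 1 := by
  obtain ⟨r, hr1, hr⟩ : ∃ r : ℝ, 1 < r ∧ max a (a * r) < min a' (a' * r) := by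
    have hc : Filter.Tendsto (fun r : ℝ => min a' (a' * r) - max a (a * r))
        (nhdsWithin 1 (Set.Ioi 1)) (nhds (min a' (a' * 1) - max a (a * 1))) :=
      (Continuous.tendsto (by fun_prop) _).mono_left nhdsWithin_le_nhds
    have h0 : 0 < min a' (a' * 1) - max a (a * 1) := by simpa using ha
    obtain ⟨r, h1, h2⟩ := ((hc.eventually (lt_mem_nhds h0)).and self_mem_nhdsWithin).exists
    exact ⟨r, h2, sub_pos.1 h1⟩
  obtain ⟨c, hc, hq⟩ := exists_Ico_measure_preimage_ne_zero hy hr1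
  have hlow : ∀ s : ℝ, c ≤ s → s < c * r → ∀ z, z ≤ a → z * s ≤ c * max a (a * r) := by
    intro s hs hs' z hz
    have h1 : z * s ≤ a * s := mul_le_mul_of_nonneg_right hz (hc.le.trans hs)
    rcases le_total 0 a with h0 | h0
    · nlinarith [le_max_right a (a * r)]
    · nlinarith [le_max_left a (a * r)]
  have hhigh : ∀ s : ℝ, c ≤ s → s < c * r → ∀ z, a' ≤ z → c * min a' (a' * r) ≤ z * s := by
    intro s hs hs' z hz
    have h1 : a' * s ≤ z * s := mul_le_mul_of_nonneg_right hz (hc.le.trans hs)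
    rcases le_total 0 a' with h0 | h0
    · nlinarith [min_le_left a' (a' * r)]
    · nlinarith [min_le_right a' (a' * r)]
  set T := Set.Ico c (c * r)
  set D := (fun ω => x ω * y ω) ⁻¹' Set.Iic (c * max a (a * r))
  have hD : NullMeasurableSet D μ := hxy.nullMeasurable measurableSet_Iic
  have hsum := measure_inter_add_sdiff₀ (y ⁻¹' T) hD
  have h1 : μ (x ⁻¹' Set.Iic a) * μ (y ⁻¹' T) ≤ μ (y ⁻¹' T ∩ D) := by
    rw [← h.measure_inter_preimage_eq_mul _ _ measurableSet_Iic measurableSet_Ico]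
    exact measure_mono fun ω hω => ⟨hω.2, hlow _ hω.2.1 hω.2.2 _ hω.1⟩
  have h2 : μ (x ⁻¹' Set.Ici a') * μ (y ⁻¹' T) ≤ μ (y ⁻¹' T \ D) := by
    rw [← h.measure_inter_preimage_eq_mul _ _ measurableSet_Ici measurableSet_Ico]
    refine measure_mono fun ω hω => ⟨hω.2, fun hD' => ?_⟩
    have h3 := hhigh _ hω.2.1 hω.2.2 _ hω.1
    have h4 : x ω * y ω ≤ c * max a (a * r) := hD'
    exact absurd (h3.trans h4) (not_le.2 (mul_lt_mul_of_pos_left hr hc))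
  have h3 : (μ (x ⁻¹' Set.Iic a) + μ (x ⁻¹' Set.Ici a')) * μ (y ⁻¹' T) ≤ 1 * μ (y ⁻¹' T) := by
    rw [add_mul, one_mul]
    exact (add_le_add h1 h2).trans hsum.le
  exact (ENNReal.mul_le_mul_iff_left hq (measure_ne_top _ _)).1 h3

theorem ProbabilityTheory.IndepFun.aemeasurable_left_of_mul_of_pos {Ω : Type*}
    [MeasurableSpace Ω] {μ : Measure Ω} [IsProbabilityMeasure μ] {x y : Ω → ℝ}
    (h : IndepFun x y μ) (hxy : AEMeasurable (fun ω => x ω * y ω) μ)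
    (hy : μ {ω | 0 < y ω} ≠ 0) : AEMeasurable x μ := by
  suffices hs : ∀ a, NullMeasurableSet (x ⁻¹' Set.Iic a) μ from
    NullMeasurable.aemeasurable (@measurable_of_Iic ℝ (NullMeasurableSpace Ω μ) _ _ _ _ _ _ _ x hs)
  intro a
  refine nullMeasurableSet_of_measure_add_measure_compl_le ?_
  obtain ⟨u, hu, hua, hlim⟩ := exists_seq_strictAnti_tendsto a
  have hcompl : (x ⁻¹' Set.Iic a)ᶜ = ⋃ n, x ⁻¹' Set.Ici (u n) := by
    ext ω
    simp only [Set.mem_compl_iff, Set.mem_preimage, Set.mem_Iic, not_le, Set.mem_iUnion,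
      Set.mem_Ici]
    constructor
    · intro hω
      obtain ⟨n, hn⟩ := (hlim.eventually (gt_mem_nhds hω)).exists
      exact ⟨n, hn.le⟩
    · rintro ⟨n, hn⟩
      exact (hua n).trans_le hn
  have hmono : Monotone fun n => x ⁻¹' Set.Ici (u n) := fun m n hmn =>
    Set.preimage_mono (Set.Ici_subset_Ici.2 (hu.antitone hmn))
  rw [hcompl, hmono.measure_iUnion, ENNReal.add_iSup]
  exact iSup_le fun n => h.measure_le_add_measure_ge_le_one hxy hy (hua n)

/-- If the product of two independent real functions is a.e. measurable and the second one does
not vanish almost everywhere, then the first one is a.e. measurable. -/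
theorem ProbabilityTheory.IndepFun.aemeasurable_left_of_mul {Ω : Type*}
    [MeasurableSpace Ω] {μ : Measure Ω} [IsProbabilityMeasure μ] {x y : Ω → ℝ}
    (h : IndepFun x y μ) (hxy : AEMeasurable (fun ω => x ω * y ω) μ)
    (hy : ¬ ∀ᵐ ω ∂μ, y ω = 0) : AEMeasurable x μ := by
  by_cases hpos : μ {ω | 0 < y ω} = 0
  · have hneg : μ {ω | 0 < -y ω} ≠ 0 := by
      intro hneg
      refine hy ?_
      rw [ae_iff]
      refine measure_mono_null ?_ (measure_union_null hpos hneg)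
      intro ω hω
      rcases lt_or_gt_of_ne (show y ω ≠ 0 from hω) with h1 | h1
      · exact Or.inr (neg_pos.2 h1)
      · exact Or.inl h1
    refine IndepFun.aemeasurable_left_of_mul_of_pos (y := fun ω => -y ω)
      (h.comp (φ := id) (ψ := fun z => -z) measurable_id measurable_neg) ?_ hneg
    exact hxy.neg.congr (ae_of_all _ fun ω => (mul_neg _ _).symm)
  · exact h.aemeasurable_left_of_mul_of_pos hxy hpos

theorem Real.exp_le_one_add_add_sq_div_two_of_nonpos {u : ℝ} (hu : u ≤ 0) :
    Real.exp u ≤ 1 + u + u ^ 2 / 2 := by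
  have h1 := Real.quadratic_le_exp_of_nonneg (neg_nonneg.2 hu)
  rw [Real.exp_neg] at h1
  have h2 := Real.exp_pos u
  have h3 : (1 + -u + (-u) ^ 2 / 2) * Real.exp u ≤ 1 := by
    calc _ ≤ (Real.exp u)⁻¹ * Real.exp u := by gcongr
      _ = 1 := inv_mul_cancel₀ h2.ne'
  have h4 : 1 ≤ (1 + u + u ^ 2 / 2) * (1 + -u + (-u) ^ 2 / 2) := by nlinarith [sq_nonneg (u ^ 2)]
  have h5 : 0 < 1 + -u + (-u) ^ 2 / 2 := by nlinarith
  refine le_of_mul_le_mul_right ?_ h5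
  linarith

theorem Real.exp_mul_sub_one_le {a u : ℝ} (ha : 0 ≤ a) (ha1 : a ≤ 1) :
    Real.exp (a * u) - 1 ≤ a * (Real.exp u - 1) := by
  have h := convexOn_exp.2 (Set.mem_univ u) (Set.mem_univ 0) ha (sub_nonneg.2 ha1) (by ring)
  simp only [smul_eq_mul, mul_zero, add_zero, Real.exp_zero, mul_one] at h
  linarith

theorem Real.sq_div_four_le_exp_sub_one_sub {u : ℝ} (hu : |u| ≤ 1) :
    u ^ 2 / 4 ≤ Real.exp u - 1 - u := by
  have h := Real.exp_bound hu (n := 3) (by norm_num)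
  norm_num [Finset.sum_range_succ, Nat.factorial] at h
  have h1 := (abs_le.1 h).1
  have h2 : |u| ^ 3 ≤ u ^ 2 := by
    rw [← sq_abs u]
    nlinarith [abs_nonneg u, sq_nonneg |u|]
  nlinarith [sq_nonneg u]

theorem lintegral_exp_sq_div_eight_le {Ω : Type*} [MeasurableSpace Ω] {μ : Measure Ω}
    {X : Ω → ℝ} (hX : Measurable X)
    (h_int : ∀ s, 0 ≤ s → Integrable (fun ω => Real.exp (s * X ω)) μ)
    (hle : ∀ s, 0 ≤ s → ∫ ω, Real.exp (s * X ω) ∂μ ≤ Real.exp (s ^ 2 / 2)) :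
    ∫⁻ ω in {ω | 0 < X ω}, ENNReal.ofReal (Real.exp (X ω ^ 2 / 8)) ∂μ ≤ 16 := by
  have hS : MeasurableSet {ω | 0 < X ω} := measurableSet_lt measurable_const hX
  let g : ℕ → ℝ → ℝ := fun n x => Real.exp ((n + 1) ^ 2 / 8 - n ^ 2) * Real.exp (n * x)
  have hpt : ∀ ω ∈ {ω | 0 < X ω}, ENNReal.ofReal (Real.exp (X ω ^ 2 / 8)) ≤
      ∑' n : ℕ, ENNReal.ofReal (g n (X ω)) := by
    intro ω hω
    have h0 : 0 < X ω := hω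
    refine le_trans ?_ (ENNReal.le_tsum ⌊X ω⌋₊)
    refine ENNReal.ofReal_le_ofReal ?_
    simp only [g]
    rw [← Real.exp_add, Real.exp_le_exp]
    have h1 := Nat.floor_le h0.le
    have h2 := Nat.lt_floor_add_one (X ω)
    have h3 : (0 : ℝ) ≤ ⌊X ω⌋₊ := Nat.cast_nonneg _
    nlinarith
  have hbound : ∀ n : ℕ, ∫⁻ ω, ENNReal.ofReal (g n (X ω)) ∂μ ≤
      ENNReal.ofReal (8 * (1 / 2) ^ n) := by
    intro n
    have hn : (0 : ℝ) ≤ n := Nat.cast_nonneg n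
    rw [← ofReal_integral_eq_lintegral_ofReal ((h_int n hn).const_mul _)
      (ae_of_all _ fun ω => by positivity)]
    refine ENNReal.ofReal_le_ofReal ?_
    rw [integral_const_mul]
    calc Real.exp (((n : ℝ) + 1) ^ 2 / 8 - n ^ 2) * ∫ ω, Real.exp (n * X ω) ∂μ
        ≤ Real.exp (((n : ℝ) + 1) ^ 2 / 8 - n ^ 2) * Real.exp ((n : ℝ) ^ 2 / 2) := by
          gcongr; exact hle n hn
      _ = Real.exp (((n : ℝ) + 1) ^ 2 / 8 - n ^ 2 + (n : ℝ) ^ 2 / 2) := (Real.exp_add _ _).symm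
      _ ≤ Real.exp (2 * 1 + n * (-1)) := by
          rw [Real.exp_le_exp]; nlinarith [sq_nonneg ((n : ℝ) - 5 / 3)]
      _ = Real.exp 1 ^ 2 * Real.exp (-1) ^ n := by
          rw [Real.exp_add, Real.exp_nat_mul, ← Real.exp_nat_mul 1 2]; norm_num
      _ ≤ 8 * (1 / 2) ^ n := by
          have h1 := Real.exp_one_lt_d9
          have h2 := Real.exp_one_gt_d9
          gcongr
          · nlinarith [Real.exp_pos 1]
          · rw [Real.exp_neg, inv_eq_one_div]
            exact one_div_le_one_div_of_le (by norm_num) (by linarith)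
  calc ∫⁻ ω in {ω | 0 < X ω}, ENNReal.ofReal (Real.exp (X ω ^ 2 / 8)) ∂μ
      ≤ ∫⁻ ω in {ω | 0 < X ω}, ∑' n : ℕ, ENNReal.ofReal (g n (X ω)) ∂μ :=
        setLIntegral_mono' hS hpt
    _ ≤ ∫⁻ ω, ∑' n : ℕ, ENNReal.ofReal (g n (X ω)) ∂μ := setLIntegral_le_lintegral _ _
    _ = ∑' n : ℕ, ∫⁻ ω, ENNReal.ofReal (g n (X ω)) ∂μ :=
        lintegral_tsum fun n => by fun_prop
    _ ≤ ∑' n : ℕ, ENNReal.ofReal (8 * (1 / 2) ^ n) := ENNReal.tsum_le_tsum hbound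
    _ = 16 := by
        rw [← ENNReal.ofReal_tsum_of_nonneg (fun n => by positivity)
          (summable_geometric_two.mul_left 8), tsum_mul_left, tsum_geometric_two]
        norm_num

theorem integrableOn_and_setIntegral_exp_sq_sub_one_le {Ω : Type*} [MeasurableSpace Ω]
    {μ : Measure Ω} {X : Ω → ℝ} (hX : Measurable X)
    (h_int : ∀ s, 0 ≤ s → Integrable (fun ω => Real.exp (s * X ω)) μ)
    (hle : ∀ s, 0 ≤ s → ∫ ω, Real.exp (s * X ω) ∂μ ≤ Real.exp (s ^ 2 / 2))
    {t : ℝ} (ht : |t| ≤ 1 / 2) :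
    IntegrableOn (fun ω => Real.exp ((t * X ω) ^ 2 / 2) - 1) {ω | 0 < X ω} μ ∧
      ∫ ω in {ω | 0 < X ω}, (Real.exp ((t * X ω) ^ 2 / 2) - 1) ∂μ ≤ 64 * t ^ 2 := by
  have ht2 : 4 * t ^ 2 ≤ 1 := by
    rw [← sq_abs]; nlinarith [abs_nonneg t]
  have hl := lintegral_exp_sq_div_eight_le hX h_int hle
  have hbig : IntegrableOn (fun ω => Real.exp (X ω ^ 2 / 8)) {ω | 0 < X ω} μ := by
    refine (lintegral_ofReal_ne_top_iff_integrable (by fun_prop)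
      (ae_of_all _ fun ω => (Real.exp_pos _).le)).1 (ne_top_of_le_ne_top (by simp) hl)
  have hpt : ∀ ω, Real.exp ((t * X ω) ^ 2 / 2) - 1 ≤ 4 * t ^ 2 * Real.exp (X ω ^ 2 / 8) := by
    intro ω
    have h := Real.exp_mul_sub_one_le (u := X ω ^ 2 / 8) (by positivity) ht2
    rw [show 4 * t ^ 2 * (X ω ^ 2 / 8) = (t * X ω) ^ 2 / 2 by ring] at h
    nlinarith [sq_nonneg t]
  have h16 : ∫ ω in {ω | 0 < X ω}, Real.exp (X ω ^ 2 / 8) ∂μ ≤ 16 := by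
    rw [integral_eq_lintegral_of_nonneg_ae (ae_of_all _ fun ω => (Real.exp_pos _).le)
      (by fun_prop)]
    exact ENNReal.toReal_le_of_le_ofReal (by norm_num) (by simpa using hl)
  have hsmall : IntegrableOn (fun ω => Real.exp ((t * X ω) ^ 2 / 2) - 1) {ω | 0 < X ω} μ := by
    refine Integrable.mono' (hbig.const_mul (4 * t ^ 2)) (by fun_prop) (ae_of_all _ fun ω => ?_)
    rw [Real.norm_of_nonneg (sub_nonneg.2 (Real.one_le_exp (by positivity)))]
    exact hpt ω
  refine ⟨hsmall, ?_⟩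
  calc _ ≤ ∫ ω in {ω | 0 < X ω}, 4 * t ^ 2 * Real.exp (X ω ^ 2 / 8) ∂μ :=
        integral_mono hsmall (hbig.const_mul _) hpt
    _ = 4 * t ^ 2 * ∫ ω in {ω | 0 < X ω}, Real.exp (X ω ^ 2 / 8) ∂μ := integral_const_mul _ _
    _ ≤ 4 * t ^ 2 * 16 := by gcongr
    _ = 64 * t ^ 2 := by ring

theorem integrable_sq_and_integral_sq_le {Ω : Type*} [MeasurableSpace Ω]
    {μ : Measure Ω} [IsProbabilityMeasure μ] {X : Ω → ℝ} (hX : Measurable X)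
    (hXint : Integrable X μ) (hmean : ∫ ω, X ω ∂μ = 0)
    (h_int : ∀ s, 0 ≤ s → Integrable (fun ω => Real.exp (s * X ω)) μ)
    (hle : ∀ s, 0 ≤ s → ∫ ω, Real.exp (s * X ω) ∂μ ≤ Real.exp (s ^ 2 / 2)) :
    Integrable (fun ω => X ω ^ 2) μ ∧ ∫ ω, X ω ^ 2 ∂μ ≤ 4 := by
  let S : ℕ → Set Ω := fun n => {ω | |X ω| ≤ n + 1}
  have hS : ∀ n, MeasurableSet (S n) := fun n =>
    measurableSet_le (by fun_prop) measurable_const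
  have hn : ∀ n, ∫⁻ ω in S n, ENNReal.ofReal (X ω ^ 2) ∂μ ≤ 4 := by
    intro n
    set s : ℝ := ((n : ℝ) + 1)⁻¹ with hs
    have hs0 : 0 < s := by positivity
    have hs1 : s ≤ 1 := inv_le_one_of_one_le₀ (by linarith [(Nat.cast_nonneg n : (0 : ℝ) ≤ n)])
    have hs2 : s ^ 2 / 2 ≤ 1 / 2 := by nlinarith
    let g : Ω → ℝ := fun ω => 4 / s ^ 2 * (Real.exp (s * X ω) - 1 - s * X ω)
    have hgint : Integrable g μ :=
      (((h_int s hs0.le).sub (integrable_const 1)).sub (hXint.const_mul s)).const_mul _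
    have hg0 : ∀ ω, 0 ≤ g ω := fun ω =>
      mul_nonneg (by positivity) (by linarith [Real.add_one_le_exp (s * X ω)])
    have hgi : ∫ ω, g ω ∂μ ≤ 4 := by
      have h1 : ∫ ω, g ω ∂μ = 4 / s ^ 2 * (∫ ω, Real.exp (s * X ω) ∂μ - 1) := by
        have h2 : ∫ ω, (Real.exp (s * X ω) - 1 - s * X ω) ∂μ =
            ∫ ω, (Real.exp (s * X ω) - 1) ∂μ - ∫ ω, s * X ω ∂μ :=
          integral_sub ((h_int s hs0.le).sub (integrable_const 1)) (hXint.const_mul s)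
        rw [integral_const_mul, h2, integral_sub (h_int s hs0.le) (integrable_const 1),
          integral_const_mul, hmean]
        simp
      have h2 : Real.exp (s ^ 2 / 2) - 1 ≤ s ^ 2 := by
        have h := Real.exp_mul_sub_one_le (u := 1 / 2) (sq_nonneg s) (by nlinarith)
        have h3 : Real.exp (1 / 2) ≤ 2 := by
          have h4 : Real.exp (1 / 2) ^ 2 = Real.exp 1 := by
            rw [← Real.exp_nat_mul]; norm_num
          nlinarith [Real.exp_one_lt_d9, Real.exp_pos (1 / 2)]
        rw [show s ^ 2 / 2 = s ^ 2 * (1 / 2) by ring]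
        nlinarith [sq_nonneg s]
      rw [h1]
      calc _ ≤ 4 / s ^ 2 * s ^ 2 := by
            gcongr; linarith [hle s hs0.le]
        _ = 4 := by field_simp
    calc ∫⁻ ω in S n, ENNReal.ofReal (X ω ^ 2) ∂μ ≤ ∫⁻ ω in S n, ENNReal.ofReal (g ω) ∂μ := by
          refine setLIntegral_mono' (hS n) fun ω hω => ENNReal.ofReal_le_ofReal ?_
          have h1 : |s * X ω| ≤ 1 := by
            rw [abs_mul, abs_of_pos hs0, hs, inv_mul_le_one₀ (by positivity)]
            exact hω
          have h2 := Real.sq_div_four_le_exp_sub_one_sub h1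
          calc X ω ^ 2 = 4 / s ^ 2 * ((s * X ω) ^ 2 / 4) := by field_simp
            _ ≤ g ω := by simp only [g]; gcongr
      _ ≤ ∫⁻ ω, ENNReal.ofReal (g ω) ∂μ := setLIntegral_le_lintegral _ _
      _ = ENNReal.ofReal (∫ ω, g ω ∂μ) :=
          (ofReal_integral_eq_lintegral_ofReal hgint (ae_of_all _ hg0)).symm
      _ ≤ ENNReal.ofReal 4 := ENNReal.ofReal_le_ofReal hgi
      _ = 4 := by norm_num
  have hmono : Monotone S := by
    intro m n hmn ω hω
    have h1 : |X ω| ≤ m + 1 := hω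
    have h2 : (m : ℝ) ≤ n := by exact_mod_cast hmn
    exact h1.trans (by linarith)
  have hU : ⋃ n, S n = Set.univ := by
    refine Set.eq_univ_of_forall fun ω => Set.mem_iUnion.2 ?_
    obtain ⟨n, h⟩ := exists_nat_ge |X ω|
    exact ⟨n, h.trans (by linarith)⟩
  have hl : ∫⁻ ω, ENNReal.ofReal (X ω ^ 2) ∂μ ≤ 4 := by
    rw [← setLIntegral_univ, ← hU,
      setLIntegral_iUnion_of_directed _ (directed_of_isDirected_le hmono)]
    exact iSup_le hn
  refine ⟨(lintegral_ofReal_ne_top_iff_integrable (by fun_prop)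
      (ae_of_all _ fun ω => sq_nonneg _)).1 (ne_top_of_le_ne_top (by simp) hl), ?_⟩
  rw [integral_eq_lintegral_of_nonneg_ae (ae_of_all _ fun ω => sq_nonneg _) (by fun_prop)]
  exact ENNReal.toReal_le_of_le_ofReal (by norm_num) (by simpa using hl)

theorem setIntegral_prod_exp_sub_one_le {ν ρ : Measure ℝ} [IsProbabilityMeasure ν]
    [IsProbabilityMeasure ρ] {t : ℝ} {S : Set ℝ}
    (hf : Integrable (fun p : ℝ × ℝ => Real.exp (t * p.1 * p.2)) (ν.prod ρ))
    (hρ : ∀ s, ∫ y, Real.exp (s * y) ∂ρ ≤ Real.exp (s ^ 2 / 2))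
    (hS : IntegrableOn (fun x => Real.exp ((t * x) ^ 2 / 2) - 1) S ν) :
    ∫ p in S ×ˢ Set.univ, (Real.exp (t * p.1 * p.2) - 1) ∂ν.prod ρ ≤
      ∫ x in S, (Real.exp ((t * x) ^ 2 / 2) - 1) ∂ν := by
  have hf1 : Integrable (fun p : ℝ × ℝ => Real.exp (t * p.1 * p.2) - 1) (ν.prod ρ) :=
    hf.sub (integrable_const 1)
  have hf2 : Integrable (fun p : ℝ × ℝ => Real.exp (t * p.1 * p.2) - 1)
      ((ν.restrict S).prod ρ) := by
    have h := hf1.integrableOn (s := S ×ˢ Set.univ)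
    rwa [IntegrableOn, ← Measure.prod_restrict, Measure.restrict_univ] at h
  rw [setIntegral_prod _ hf1.integrableOn]
  simp only [Measure.restrict_univ]
  refine integral_mono_ae hf2.integral_prod_left hS ?_
  filter_upwards [ae_restrict_of_ae hf.prod_right_ae] with x hx
  have h : ∫ y, (Real.exp (t * x * y) - 1) ∂ρ = ∫ y, Real.exp (t * x * y) ∂ρ - 1 := by
    rw [integral_sub hx (integrable_const 1)]
    simp
  simp only [h]
  linarith [hρ (t * x)]

theorem integral_exp_mul_le_of_forall_integrable {ν ρ : Measure ℝ} [IsProbabilityMeasure ν]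
    [IsProbabilityMeasure ρ] {t : ℝ} (ht : |t| ≤ 1 / 2)
    (hf : Integrable (fun p : ℝ × ℝ => Real.exp (t * p.1 * p.2)) (ν.prod ρ))
    (hν : ∀ s, ∫ x, Real.exp (s * x) ∂ν ≤ Real.exp (s ^ 2 / 2))
    (hρ : ∀ s, ∫ y, Real.exp (s * y) ∂ρ ≤ Real.exp (s ^ 2 / 2))
    (h_int : ∀ s, Integrable (fun x => Real.exp (s * x)) ν) :
    ∫ p, Real.exp (t * p.1 * p.2) ∂ν.prod ρ ≤ 1 + 128 * t ^ 2 := by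
  obtain ⟨hp1, hp2⟩ := integrableOn_and_setIntegral_exp_sq_sub_one_le (X := fun x : ℝ => x)
    measurable_id (fun s _ => h_int s) (fun s _ => hν s) ht
  obtain ⟨hn1, hn2⟩ := integrableOn_and_setIntegral_exp_sq_sub_one_le (X := fun x : ℝ => -x)
    (μ := ν) measurable_neg (fun s _ => by simpa using h_int (-s))
    (fun s _ => by simpa using hν (-s)) ht
  simp only [mul_neg, neg_sq] at hn1 hn2
  have hP : MeasurableSet {x : ℝ | 0 < x} := measurableSet_Ioi
  have hN : MeasurableSet {x : ℝ | 0 < -x} := measurableSet_lt measurable_const measurable_neg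
  have hsplit : (fun x : ℝ => Real.exp ((t * x) ^ 2 / 2) - 1) = fun x =>
      Set.indicator {x : ℝ | 0 < x} (fun x : ℝ => Real.exp ((t * x) ^ 2 / 2) - 1) x +
      Set.indicator {x : ℝ | 0 < -x} (fun x : ℝ => Real.exp ((t * x) ^ 2 / 2) - 1) x := by
    ext x
    rcases lt_trichotomy x 0 with h | rfl | h
    · simp [Set.indicator, h, h.not_gt]
    · simp
    · simp [Set.indicator, h, h.not_gt]
  have hall : Integrable (fun x : ℝ => Real.exp ((t * x) ^ 2 / 2) - 1) ν := by
    rw [hsplit]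
    exact (hp1.integrable_indicator hP).add (hn1.integrable_indicator hN)
  have hval : ∫ x, (Real.exp ((t * x) ^ 2 / 2) - 1) ∂ν ≤ 128 * t ^ 2 := by
    rw [hsplit, integral_add (hp1.integrable_indicator hP) (hn1.integrable_indicator hN),
      integral_indicator hP, integral_indicator hN]
    linarith
  have h := setIntegral_prod_exp_sub_one_le hf hρ hall.integrableOn (S := Set.univ)
  rw [Set.univ_prod_univ, setIntegral_univ, setIntegral_univ,
    integral_sub hf (integrable_const 1)] at h
  simp only [integral_const, probReal_univ, smul_eq_mul, mul_one] at h
  linarith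

/-- The product bound when both laws have finite second moments and the exponential moments of
`ν` are finite on the right and those of `ρ` on the left. -/
theorem integral_exp_mul_le_of_one_sided_of_integrable {ν ρ : Measure ℝ}
    [IsProbabilityMeasure ν] [IsProbabilityMeasure ρ] {t : ℝ} (ht0 : 0 ≤ t) (ht : t ≤ 1 / 2)
    (hf : Integrable (fun p : ℝ × ℝ => Real.exp (t * p.1 * p.2)) (ν.prod ρ))
    (hν0 : ∫ x, x ∂ν = 0) (hρ0 : ∫ y, y ∂ρ = 0)
    (hν : ∀ s, ∫ x, Real.exp (s * x) ∂ν ≤ Real.exp (s ^ 2 / 2))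
    (hρ : ∀ s, ∫ y, Real.exp (s * y) ∂ρ ≤ Real.exp (s ^ 2 / 2))
    (hνint : ∀ s, 0 ≤ s → Integrable (fun x => Real.exp (s * x)) ν)
    (hρint : ∀ s, s ≤ 0 → Integrable (fun y => Real.exp (s * y)) ρ)
    (hνid : Integrable (fun x : ℝ => x) ν) (hρid : Integrable (fun y : ℝ => y) ρ) :
    ∫ p, Real.exp (t * p.1 * p.2) ∂ν.prod ρ ≤ 1 + 136 * t ^ 2 := by
  have ht' : |t| ≤ 1 / 2 := by rwa [abs_of_nonneg ht0]
  have hρint' : ∀ s, 0 ≤ s → Integrable (fun y => Real.exp (s * -y)) ρ := fun s hs => by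
    simpa using hρint (-s) (neg_nonpos.2 hs)
  have hρ' : ∀ s, 0 ≤ s → ∫ y, Real.exp (s * -y) ∂ρ ≤ Real.exp (s ^ 2 / 2) := fun s _ => by
    simpa using hρ (-s)
  obtain ⟨hp1, hp2⟩ := integrableOn_and_setIntegral_exp_sq_sub_one_le (X := fun x : ℝ => x)
    measurable_id hνint (fun s _ => hν s) ht'
  obtain ⟨hn1, hn2⟩ := integrableOn_and_setIntegral_exp_sq_sub_one_le (X := fun y : ℝ => -y)
    measurable_neg hρint' hρ' ht'
  simp only [mul_neg, neg_sq] at hn1 hn2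
  obtain ⟨hx1, hx2⟩ := integrable_sq_and_integral_sq_le (X := fun x : ℝ => x)
    measurable_id hνid hν0 hνint (fun s _ => hν s)
  obtain ⟨hy1, hy2⟩ := integrable_sq_and_integral_sq_le (X := fun y : ℝ => -y)
    measurable_neg hρid.neg (by rw [integral_neg, hρ0, neg_zero]) hρint' hρ'
  simp only [neg_sq] at hy1 hy2
  set P : Set ℝ := {x : ℝ | 0 < x} with hPdef
  set N : Set ℝ := {y : ℝ | 0 < -y} with hNdef
  have hP : MeasurableSet P := measurableSet_Ioi
  have hN : MeasurableSet N := measurableSet_lt measurable_const measurable_neg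
  set f : ℝ × ℝ → ℝ := fun p => Real.exp (t * p.1 * p.2) with hfdef
  have hf1 : Integrable (fun p => f p - 1) (ν.prod ρ) := hf.sub (integrable_const 1)
  have hu : Integrable (fun p : ℝ × ℝ => t * (p.1 * p.2)) (ν.prod ρ) :=
    (hνid.mul_prod hρid).const_mul t
  have hu2 : Integrable (fun p : ℝ × ℝ => t ^ 2 / 2 * (p.1 ^ 2 * p.2 ^ 2)) (ν.prod ρ) :=
    (hx1.mul_prod hy1).const_mul _
  let g : ℝ × ℝ → ℝ := fun p => f p - 1 - t * (p.1 * p.2)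
  have hg : Integrable g (ν.prod ρ) := hf1.sub hu
  have hA : MeasurableSet (P ×ˢ (Set.univ : Set ℝ)) := hP.prod MeasurableSet.univ
  have hB : MeasurableSet ((Set.univ : Set ℝ) ×ˢ N) := MeasurableSet.univ.prod hN
  have hgA : ∫ p in P ×ˢ Set.univ, g p ∂ν.prod ρ ≤ 64 * t ^ 2 := by
    rw [integral_sub hf1.integrableOn hu.integrableOn, integral_const_mul,
      setIntegral_prod_mul (fun x : ℝ => x) (fun y : ℝ => y), setIntegral_univ, hρ0, mul_zero,
      mul_zero, sub_zero]
    exact (setIntegral_prod_exp_sub_one_le hf hρ hp1).trans hp2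
  have hgB : ∫ p in Set.univ ×ˢ N, g p ∂ν.prod ρ ≤ 64 * t ^ 2 := by
    rw [integral_sub hf1.integrableOn hu.integrableOn, integral_const_mul,
      setIntegral_prod_mul (fun x : ℝ => x) (fun y : ℝ => y), setIntegral_univ, hν0, zero_mul,
      mul_zero, sub_zero, ← setIntegral_prod_swap]
    have hsw : ∀ p : ℝ × ℝ, f p.swap = Real.exp (t * p.1 * p.2) := by
      intro p
      simp only [hfdef, Prod.fst_swap, Prod.snd_swap]
      ring_nf
    have hfs : Integrable (fun p : ℝ × ℝ => Real.exp (t * p.1 * p.2)) (ρ.prod ν) := by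
      simpa only [Function.comp_def, hsw] using hf.swap
    have h := (setIntegral_prod_exp_sub_one_le hfs hν hn1).trans hn2
    simpa only [hsw] using h
  have hpt : ∀ p, f p ≤ 1 + t * (p.1 * p.2) + t ^ 2 / 2 * (p.1 ^ 2 * p.2 ^ 2) +
      (P ×ˢ Set.univ).indicator g p + (Set.univ ×ˢ N).indicator g p := by
    rintro ⟨x, y⟩
    have hg0 : 0 ≤ g (x, y) := by
      have := Real.add_one_le_exp (t * x * y)
      simp only [g, hfdef]
      linarith
    have hsq : 0 ≤ t ^ 2 / 2 * (x ^ 2 * y ^ 2) := by positivity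
    have hfg : f (x, y) = 1 + t * (x * y) + g (x, y) := by simp only [g]; ring
    by_cases hx : 0 < x
    · have h1 : (P ×ˢ Set.univ).indicator g (x, y) = g (x, y) :=
        Set.indicator_of_mem (by simpa [hPdef] using hx) _
      have h2 : 0 ≤ (Set.univ ×ˢ N).indicator g (x, y) := by
        by_cases hy : (x, y) ∈ (Set.univ : Set ℝ) ×ˢ N <;> simp [Set.indicator, hy, hg0]
      simp only
      linarith
    · have h1 : (P ×ˢ Set.univ).indicator g (x, y) = 0 :=
        Set.indicator_of_notMem (by simpa [hPdef] using hx) _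
      by_cases hy : 0 < -y
      · have h2 : (Set.univ ×ˢ N).indicator g (x, y) = g (x, y) :=
          Set.indicator_of_mem (by simpa [hNdef] using hy) _
        simp only
        linarith
      · have h2 : (Set.univ ×ˢ N).indicator g (x, y) = 0 :=
          Set.indicator_of_notMem (by simpa [hNdef] using hy) _
        have hneg : t * x * y ≤ 0 := by
          rw [mul_assoc]
          exact mul_nonpos_of_nonneg_of_nonpos ht0
            (mul_nonpos_of_nonpos_of_nonneg (not_lt.1 hx) (by linarith))
        have h3 := Real.exp_le_one_add_add_sq_div_two_of_nonpos hneg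
        simp only [h1, h2, hfdef]
        nlinarith
  have hI1 := (integrable_const (μ := ν.prod ρ) (1 : ℝ)).add hu
  have hI2 := hI1.add hu2
  have hI3 := hI2.add (hg.indicator hA)
  have hI4 := hI3.add (hg.indicator hB)
  have hle := integral_mono hf hI4 hpt
  rw [integral_add' hI3 (hg.indicator hB), integral_add' hI2 (hg.indicator hA),
    integral_add' hI1 hu2, integral_add' (integrable_const 1) hu, integral_indicator hA,
    integral_indicator hB, integral_const_mul, integral_const_mul,
    integral_prod_mul (fun x : ℝ => x) (fun y : ℝ => y),
    integral_prod_mul (fun x : ℝ => x ^ 2) (fun y : ℝ => y ^ 2), hν0] at hle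
  simp only [integral_const, probReal_univ, smul_eq_mul, mul_one, zero_mul, mul_zero,
    add_zero] at hle
  have h16 : (∫ x, x ^ 2 ∂ν) * ∫ y, y ^ 2 ∂ρ ≤ 4 * 4 :=
    mul_le_mul hx2 hy2 (integral_nonneg fun y => sq_nonneg y) (by norm_num)
  nlinarith [sq_nonneg t]

theorem integrable_id_of_integrable_exp_mul {ρ : Measure ℝ} {s : ℝ} (hs : 0 < s)
    (hpos : Integrable (fun y => Real.exp (s * y)) ρ)
    (hneg : Integrable (fun y => Real.exp (-s * y)) ρ) : Integrable (fun y : ℝ => y) ρ := by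
  refine Integrable.mono' ((hpos.add hneg).const_mul s⁻¹) measurable_id.aestronglyMeasurable
    (ae_of_all _ fun y => ?_)
  simp only [Pi.add_apply, Real.norm_eq_abs]
  rw [le_inv_mul_iff₀ hs]
  have h1 := Real.add_one_le_exp (s * y)
  have h2 := Real.add_one_le_exp (-s * y)
  have h3 := Real.exp_pos (s * y)
  have h4 := Real.exp_pos (-s * y)
  rcases abs_cases y with ⟨h, -⟩ | ⟨h, -⟩ <;> rw [h] <;> linarith

theorem integral_exp_mul_le_one_of_ae_nonpos {ν ρ : Measure ℝ} [IsProbabilityMeasure ν]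
    [IsProbabilityMeasure ρ] {t : ℝ} (ht : 0 ≤ t)
    (hf : Integrable (fun p : ℝ × ℝ => Real.exp (t * p.1 * p.2)) (ν.prod ρ))
    (hxy : ∀ᵐ p ∂ν.prod ρ, p.1 * p.2 ≤ 0) :
    ∫ p, Real.exp (t * p.1 * p.2) ∂ν.prod ρ ≤ 1 := by
  have h := integral_mono_ae (g := fun _ => 1) hf (integrable_const 1) (by
    filter_upwards [hxy] with p hp
    rw [Real.exp_le_one_iff, mul_assoc]
    exact mul_nonpos_of_nonneg_of_nonpos ht hp)
  simpa using h

theorem integral_exp_mul_le_of_one_sided {ν ρ : Measure ℝ}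
    [IsProbabilityMeasure ν] [IsProbabilityMeasure ρ] {t : ℝ} (ht0 : 0 < t) (ht : t ≤ 1 / 2)
    (hf : Integrable (fun p : ℝ × ℝ => Real.exp (t * p.1 * p.2)) (ν.prod ρ))
    (hν0 : ∫ x, x ∂ν = 0) (hρ0 : ∫ y, y ∂ρ = 0)
    (hν : ∀ s, ∫ x, Real.exp (s * x) ∂ν ≤ Real.exp (s ^ 2 / 2))
    (hρ : ∀ s, ∫ y, Real.exp (s * y) ∂ρ ≤ Real.exp (s ^ 2 / 2))
    (hνint : ∀ s, 0 ≤ s → Integrable (fun x => Real.exp (s * x)) ν)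
    (hρint : ∀ s, s ≤ 0 → Integrable (fun y => Real.exp (s * y)) ρ) :
    ∫ p, Real.exp (t * p.1 * p.2) ∂ν.prod ρ ≤ 1 + 136 * t ^ 2 := by
  have hx : ¬ Integrable (fun y : ℝ => y) ρ → ∀ᵐ x ∂ν, x ≤ 0 := by
    intro hρid
    filter_upwards [hf.prod_right_ae] with x hx
    by_contra! h0
    have h1 : 0 < t * x := mul_pos ht0 h0
    exact hρid (integrable_id_of_integrable_exp_mul h1 hx (hρint _ (neg_nonpos.2 h1.le)))
  have hy : ¬ Integrable (fun x : ℝ => x) ν → ∀ᵐ y ∂ρ, 0 ≤ y := by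
    intro hνid
    filter_upwards [hf.prod_left_ae] with y hy
    by_contra! h0
    have h1 : 0 < -(t * y) := neg_pos.2 (mul_neg_of_pos_of_neg ht0 h0)
    refine hνid (integrable_id_of_integrable_exp_mul h1 (hνint _ h1.le) ?_)
    simpa only [neg_neg, mul_right_comm] using hy
  have hfst : ∀ {q : ℝ → Prop}, (∀ᵐ x ∂ν, q x) → ∀ᵐ p ∂ν.prod ρ, q p.1 := fun h =>
    Measure.quasiMeasurePreserving_fst.ae h
  have hsnd : ∀ {q : ℝ → Prop}, (∀ᵐ y ∂ρ, q y) → ∀ᵐ p ∂ν.prod ρ, q p.2 := fun h =>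
    Measure.quasiMeasurePreserving_snd.ae h
  suffices hcase : (Integrable (fun x : ℝ => x) ν ∧ Integrable (fun y : ℝ => y) ρ) ∨
      ∀ᵐ p ∂ν.prod ρ, p.1 * p.2 ≤ 0 by
    rcases hcase with ⟨h1, h2⟩ | h
    · exact integral_exp_mul_le_of_one_sided_of_integrable ht0.le ht hf hν0 hρ0 hν hρ hνint
        hρint h1 h2
    · exact (integral_exp_mul_le_one_of_ae_nonpos ht0.le hf h).trans
        (le_add_of_nonneg_right (by positivity))
  by_cases hνid : Integrable (fun x : ℝ => x) ν <;>
    by_cases hρid : Integrable (fun y : ℝ => y) ρ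
  · exact Or.inl ⟨hνid, hρid⟩
  · have h0 : ∀ᵐ x ∂ν, -x = 0 := (integral_eq_zero_iff_of_nonneg_ae
      (by filter_upwards [hx hρid] with x h using neg_nonneg.2 h) hνid.neg).1
      ((integral_neg _).trans (by rw [hν0, neg_zero]))
    right
    filter_upwards [hfst h0] with p hp
    rw [neg_eq_zero.1 hp, zero_mul]
  · have h0 : ∀ᵐ y ∂ρ, y = 0 := (integral_eq_zero_iff_of_nonneg_ae (hy hνid) hρid).1 hρ0
    right
    filter_upwards [hsnd h0] with p hp
    rw [hp, mul_zero]
  · right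
    filter_upwards [hfst (hx hρid), hsnd (hy hνid)] with p h1 h2
    exact mul_nonpos_of_nonpos_of_nonneg h1 h2

theorem ae_lt_of_not_integrable_exp_mul {ν ρ : Measure ℝ} [IsFiniteMeasure ρ] {t s : ℝ}
    (ht : 0 < t) (hs : 0 ≤ s) (hbad : ¬ Integrable (fun y => Real.exp (s * y)) ρ)
    (h : ∀ᵐ x ∂ν, Integrable (fun y => Real.exp (t * x * y)) ρ) : ∀ᵐ x ∂ν, x ≤ s / t := by
  filter_upwards [h] with x hx
  by_contra! hlt
  rw [div_lt_iff₀ ht, mul_comm] at hlt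
  exact hbad (integrable_exp_mul_of_nonneg_of_le hx hs hlt.le)

theorem ae_ge_of_not_integrable_exp_mul {ν ρ : Measure ℝ} [IsFiniteMeasure ρ] {t s : ℝ}
    (ht : 0 < t) (hs : s ≤ 0) (hbad : ¬ Integrable (fun y => Real.exp (s * y)) ρ)
    (h : ∀ᵐ x ∂ν, Integrable (fun y => Real.exp (t * x * y)) ρ) : ∀ᵐ x ∂ν, s / t ≤ x := by
  filter_upwards [h] with x hx
  by_contra! hlt
  rw [lt_div_iff₀ ht, mul_comm] at hlt
  exact hbad (integrable_exp_mul_of_nonpos_of_ge hx hs hlt.le)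

theorem integrable_exp_mul_of_nonpos_of_ae_ge {ν : Measure ℝ} [IsFiniteMeasure ν] {s b : ℝ}
    (hs : s ≤ 0) (hb : ∀ᵐ x ∂ν, b ≤ x) : Integrable (fun x => Real.exp (s * x)) ν := by
  have h := integrable_exp_mul_of_le (μ := ν) (X := fun x : ℝ => -x) (-s) (-b)
    (neg_nonneg.2 hs) measurable_neg.aemeasurable
    (by filter_upwards [hb] with x hx using neg_le_neg hx)
  simpa using h

theorem integral_exp_mul_le {ν ρ : Measure ℝ}
    [IsProbabilityMeasure ν] [IsProbabilityMeasure ρ] {t : ℝ} (ht0 : 0 < t) (ht : t ≤ 1 / 2)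
    (hf : Integrable (fun p : ℝ × ℝ => Real.exp (t * p.1 * p.2)) (ν.prod ρ))
    (hν0 : ∫ x, x ∂ν = 0) (hρ0 : ∫ y, y ∂ρ = 0)
    (hν : ∀ s, ∫ x, Real.exp (s * x) ∂ν ≤ Real.exp (s ^ 2 / 2))
    (hρ : ∀ s, ∫ y, Real.exp (s * y) ∂ρ ≤ Real.exp (s ^ 2 / 2)) :
    ∫ p, Real.exp (t * p.1 * p.2) ∂ν.prod ρ ≤ 1 + 136 * t ^ 2 := by
  have ht' : |t| ≤ 1 / 2 := by rwa [abs_of_pos ht0]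
  have hcomm : ∀ p : ℝ × ℝ, Real.exp (t * p.swap.1 * p.swap.2) = Real.exp (t * p.1 * p.2) :=
    fun p => by rw [Prod.fst_swap, Prod.snd_swap, mul_right_comm]
  have hf' : Integrable (fun p : ℝ × ℝ => Real.exp (t * p.1 * p.2)) (ρ.prod ν) := by
    simpa only [Function.comp_def, hcomm] using hf.swap
  have hswap : ∫ p, Real.exp (t * p.1 * p.2) ∂ν.prod ρ =
      ∫ p, Real.exp (t * p.1 * p.2) ∂ρ.prod ν := by
    rw [← integral_prod_swap]
    simp only [hcomm]
  have hνae := hf.prod_right_ae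
  have hρae := hf'.prod_right_ae
  by_cases hνall : ∀ s, Integrable (fun x => Real.exp (s * x)) ν
  · exact (integral_exp_mul_le_of_forall_integrable ht' hf hν hρ hνall).trans
      (by linarith [sq_nonneg t])
  by_cases hρall : ∀ s, Integrable (fun y => Real.exp (s * y)) ρ
  · rw [hswap]
    exact (integral_exp_mul_le_of_forall_integrable ht' hf' hρ hν hρall).trans
      (by linarith [sq_nonneg t])
  push Not at hνall hρall
  obtain ⟨r, hr⟩ := hνall
  obtain ⟨s, hs⟩ := hρall
  rcases le_total 0 s with hs0 | hs0
  · have hνint : ∀ u, 0 ≤ u → Integrable (fun x => Real.exp (u * x)) ν := fun u hu =>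
      integrable_exp_mul_of_le u _ hu measurable_id.aemeasurable
        (ae_lt_of_not_integrable_exp_mul ht0 hs0 hs hνae)
    have hr0 : r ≤ 0 := le_of_not_ge fun h => hr (hνint r h)
    exact integral_exp_mul_le_of_one_sided ht0 ht hf hν0 hρ0 hν hρ hνint fun u hu =>
      integrable_exp_mul_of_nonpos_of_ae_ge hu
        (ae_ge_of_not_integrable_exp_mul ht0 hr0 hr hρae)
  · have hνint : ∀ u, u ≤ 0 → Integrable (fun x => Real.exp (u * x)) ν := fun u hu =>
      integrable_exp_mul_of_nonpos_of_ae_ge hu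
        (ae_ge_of_not_integrable_exp_mul ht0 hs0 hs hνae)
    have hr0 : 0 ≤ r := le_of_not_ge fun h => hr (hνint r h)
    rw [hswap]
    exact integral_exp_mul_le_of_one_sided ht0 ht hf' hρ0 hν0 hρ hν (fun u hu =>
      integrable_exp_mul_of_le u _ hu measurable_id.aemeasurable
        (ae_lt_of_not_integrable_exp_mul ht0 hr0 hr hρae)) hνint

theorem aemeasurable_mul_of_integrable_exp {Ω : Type*} [MeasurableSpace Ω] {μ : Measure Ω}
    {x y : Ω → ℝ} {t : ℝ} (ht : t ≠ 0)
    (h : Integrable (fun ω => Real.exp (t * x ω * y ω)) μ) :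
    AEMeasurable (fun ω => x ω * y ω) μ := by
  have h1 := (Real.measurable_log.comp_aemeasurable h.1.aemeasurable).const_mul t⁻¹
  refine h1.congr (ae_of_all _ fun ω => ?_)
  simp only [Function.comp_apply, Real.log_exp]
  field_simp

theorem integral_map_mul_and_exp_le {Ω : Type*} [MeasurableSpace Ω] {μ : Measure Ω}
    {x : Ω → ℝ} (hx : AEMeasurable x μ) {c σ : ℝ} (hc : (σ * c) ^ 2 = 1)
    (hx0 : ∫ ω, x ω ∂μ = 0)
    (hle : ∀ t : ℝ, ∫ ω, Real.exp (t * x ω) ∂μ ≤ Real.exp (σ ^ 2 * t ^ 2 / 2)) :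
    ∫ z, z ∂(μ.map fun ω => c * x ω) = 0 ∧
      ∀ s, ∫ z, Real.exp (s * z) ∂(μ.map fun ω => c * x ω) ≤ Real.exp (s ^ 2 / 2) := by
  refine ⟨?_, fun s => ?_⟩
  · rw [integral_map (f := fun z : ℝ => z) (hx.const_mul c) measurable_id.aestronglyMeasurable,
      integral_const_mul, hx0, mul_zero]
  · rw [integral_map (hx.const_mul c) (by fun_prop)]
    have h := hle (s * c)
    rw [show σ ^ 2 * (s * c) ^ 2 / 2 = (σ * c) ^ 2 * s ^ 2 / 2 by ring, hc, one_mul] at h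
    simpa only [mul_assoc] using h

/-- If `x` is a centered `σx²`-subgaussian random variable and `y` an independent centered
`σy²`-subgaussian random variable, there is a universal constant `b` such that
`E[exp(t·x·y)] ≤ exp(b² σx² σy² t²)` for all `|t| ≤ (b σx σy)⁻¹`. -/
theorem stmt_5 :
    ∃ b : ℝ, 1 ≤ b ∧
      ∀ (Ω : Type) [MeasurableSpace Ω] (μ : Measure Ω) [IsProbabilityMeasure μ]
        (x y : Ω → ℝ) (σx σy : ℝ), 0 < σx → 0 < σy →
        (∫ ω, x ω ∂μ) = 0 → (∫ ω, y ω ∂μ) = 0 →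
        (∀ t : ℝ, ∫ ω, Real.exp (t * x ω) ∂μ ≤ Real.exp (σx ^ 2 * t ^ 2 / 2)) →
        (∀ t : ℝ, ∫ ω, Real.exp (t * y ω) ∂μ ≤ Real.exp (σy ^ 2 * t ^ 2 / 2)) →
        IndepFun x y μ →
        ∀ t : ℝ, |t| ≤ (b * σx * σy)⁻¹ →
          ∫ ω, Real.exp (t * x ω * y ω) ∂μ ≤ Real.exp (b ^ 2 * σx ^ 2 * σy ^ 2 * t ^ 2) := by
  refine ⟨12, by norm_num, ?_⟩
  intro Ω _ μ _ x y σx σy hσx hσy hx0 hy0 hx hy hind t ht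
  have hrhs : 1 ≤ Real.exp (12 ^ 2 * σx ^ 2 * σy ^ 2 * t ^ 2) :=
    Real.one_le_exp (by positivity)
  by_cases h_int : Integrable (fun ω => Real.exp (t * x ω * y ω)) μ
  swap
  · rw [integral_undef h_int]
    exact (Real.exp_pos _).le
  have hzero : (∀ᵐ ω ∂μ, t * x ω * y ω = 0) →
      ∫ ω, Real.exp (t * x ω * y ω) ∂μ ≤ Real.exp (12 ^ 2 * σx ^ 2 * σy ^ 2 * t ^ 2) := by
    intro h
    have h1 : ∫ ω, Real.exp (t * x ω * y ω) ∂μ = ∫ _, (1 : ℝ) ∂μ :=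
      integral_congr_ae (by filter_upwards [h] with ω hω; rw [hω, Real.exp_zero])
    rw [h1]
    simpa using hrhs
  by_cases ht0 : t = 0
  · exact hzero (ae_of_all _ fun ω => by rw [ht0, zero_mul, zero_mul])
  by_cases hyz : ∀ᵐ ω ∂μ, y ω = 0
  · exact hzero (by filter_upwards [hyz] with ω hω; rw [hω, mul_zero])
  by_cases hxz : ∀ᵐ ω ∂μ, x ω = 0
  · exact hzero (by filter_upwards [hxz] with ω hω; rw [hω, mul_zero, zero_mul])
  have hxy := aemeasurable_mul_of_integrable_exp ht0 h_int
  have hxm : AEMeasurable x μ := hind.aemeasurable_left_of_mul hxy hyz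
  have hym : AEMeasurable y μ :=
    hind.symm.aemeasurable_left_of_mul (by simpa only [mul_comm] using hxy) hxz
  have hc : (σx * (t / |t| / σx)) ^ 2 = 1 := by
    rw [mul_div_cancel₀ _ hσx.ne', div_pow, sq_abs, div_self (pow_ne_zero 2 ht0)]
  have hd : (σy * σy⁻¹) ^ 2 = 1 := by rw [mul_inv_cancel₀ hσy.ne', one_pow]
  set c := t / |t| / σx with hcdef
  set d := σy⁻¹ with hddef
  set τ := |t| * σx * σy with hτ
  have hτ0 : 0 < τ := by positivity
  have hτ1 : τ ≤ 1 / 2 := by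
    have h1 : |t| * (12 * σx * σy) ≤ 1 := by
      rwa [← le_div_iff₀ (by positivity), one_div]
    have h2 : 12 * τ ≤ 1 := by rw [hτ]; linarith
    linarith
  have hprod : ∀ ω, τ * (c * x ω) * (d * y ω) = t * x ω * y ω := by
    intro ω
    have h0 : |t| ≠ 0 := abs_ne_zero.2 ht0
    rw [hτ, hcdef, hddef]
    field_simp
  obtain ⟨hν0, hν⟩ := integral_map_mul_and_exp_le hxm hc hx0 hx
  obtain ⟨hρ0, hρ⟩ := integral_map_mul_and_exp_le hym hd hy0 hy
  have hX := hxm.const_mul c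
  have hY := hym.const_mul d
  have hind' : IndepFun (fun ω => c * x ω) (fun ω => d * y ω) μ :=
    hind.comp (φ := fun z => c * z) (ψ := fun z => d * z) (by fun_prop) (by fun_prop)
  have hmap := (indepFun_iff_map_prod_eq_prod_map_map hX hY).1 hind'
  have := Measure.isProbabilityMeasure_map hX
  have := Measure.isProbabilityMeasure_map hY
  have hf : Integrable (fun p : ℝ × ℝ => Real.exp (τ * p.1 * p.2))
      ((μ.map fun ω => c * x ω).prod (μ.map fun ω => d * y ω)) := by
    rw [← hmap, integrable_map_measure (by fun_prop) (hX.prodMk hY)]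
    simpa only [Function.comp_def, hprod] using h_int
  have h := integral_exp_mul_le hτ0 hτ1 hf hν0 hρ0 hν hρ
  rw [← hmap, integral_map (hX.prodMk hY) (by fun_prop)] at h
  simp only [hprod] at h
  have hexp := Real.add_one_le_exp (12 ^ 2 * σx ^ 2 * σy ^ 2 * t ^ 2)
  have hτ2 : τ ^ 2 = σx ^ 2 * σy ^ 2 * t ^ 2 := by rw [hτ, mul_pow, mul_pow, sq_abs]; ring
  nlinarith [sq_nonneg τ]
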